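/- Let f be an analytic function on 𝔻 with f(z) = z + Σ_{n≥2} a_n z^n and Re f'(z) > 0 for all z ∈ 𝔻 (i.e. f ∈ ℛ, the class of functions of bounded turning), and let γ_1, γ_2 be its logarithmic coefficients. Then −1/√5 ≤ |γ_2| − |γ_1| ≤ 1/3. Both inequalities are sharp. -/

import Mathlib

open Metric Filter Set

/-- The class `ℛ` of functions of bounded turning: analytic
`f(z) = z + ∑_{n≥2} aₙ zⁿ` on the unit disk with `Re f'(z) > 0`. -/
def IsR (a : ℕ → ℂ) (f : ℂ → ℂ) : Prop :=
  a 0 = 0 ∧ a 1 = 1 ∧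
  (∀ z ∈ Metric.ball (0 : ℂ) 1, HasSum (fun n => a n * z ^ n) (f z)) ∧
  ∀ z ∈ Metric.ball (0 : ℂ) 1, 0 < (deriv f z).re

open scoped ComplexConjugate Topology

/-- The sum of a power series converging on the open unit disk is holomorphic there. -/
lemma differentiableOn_ball_of_hasSum {c : ℕ → ℂ} {g : ℂ → ℂ}
    (h : ∀ z ∈ ball (0 : ℂ) 1, HasSum (fun n => c n * z ^ n) (g z)) :
    DifferentiableOn ℂ g (ball 0 1) := by
  have hp : HasFPowerSeriesOnBall g (FormalMultilinearSeries.ofScalars ℂ c) 0 1 := by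
    refine ⟨ENNReal.le_of_forall_nnreal_lt fun r hr => ?_, one_pos, fun {y} hy => ?_⟩
    · have hr' : ((r : ℝ) : ℂ) ∈ ball (0 : ℂ) 1 := by
        simpa using (by exact_mod_cast hr : r < 1)
      refine FormalMultilinearSeries.le_radius_of_tendsto _ (l := 0) ?_
      simpa [FormalMultilinearSeries.ofScalars_norm] using
        (h _ hr').summable.tendsto_atTop_zero.norm
    · have hy' : y ∈ ball (0 : ℂ) 1 := by
        rwa [show (1 : ENNReal) = ENNReal.ofReal 1 by simp, Metric.eball_ofReal] at hy
      simpa [FormalMultilinearSeries.ofScalars_apply_eq, mul_comm] using h y hy'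
  have := hp.differentiableOn
  rwa [show (1 : ENNReal) = ENNReal.ofReal 1 by simp, Metric.eball_ofReal] at this

/-- Dropping the first `k` coefficients of a power series on the unit disk. -/
lemma exists_hasSum_shift {c : ℕ → ℂ} {g : ℂ → ℂ} (k : ℕ)
    (h : ∀ z ∈ ball (0 : ℂ) 1, HasSum (fun n => c n * z ^ n) (g z)) :
    ∃ t : ℂ → ℂ, DifferentiableOn ℂ t (ball 0 1) ∧
      ∀ z ∈ ball (0 : ℂ) 1, g z = (∑ n ∈ Finset.range k, c n * z ^ n) + z ^ k * t z := by
  have hs : ∀ z ∈ ball (0 : ℂ) 1, Summable (fun n => c (n + k) * z ^ n) := by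
    intro z hz
    rcases eq_or_ne z 0 with rfl | h0
    · refine summable_of_ne_finset_zero (s := {0}) fun n hn => ?_
      simp [show n ≠ 0 by simpa using hn]
    · have := ((summable_nat_add_iff k).2 (h z hz).summable).mul_right (z ^ k)⁻¹
      refine this.congr fun n => ?_
      field_simp
      ring
  refine ⟨fun z => ∑' n, c (n + k) * z ^ n,
    differentiableOn_ball_of_hasSum fun z hz => (hs z hz).hasSum, fun z hz => ?_⟩
  rw [← (h z hz).tsum_eq, ← (h z hz).summable.sum_add_tsum_nat_add k, ← tsum_mul_left]
  congr 2
  ext n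
  ring

/-- If `f' = 1 + z q` near `0`, then `q(0) = 2 a₂` and `q'(0) = 3 a₃`. -/
lemma IsR.coeff_of_deriv_eq {a : ℕ → ℂ} {f q : ℂ → ℂ} (hf : IsR a f)
    (hq : ContinuousAt q 0) (h : ∀ᶠ z in 𝓝 0, deriv f z = 1 + z * q z) :
    q 0 = 2 * a 2 ∧ deriv q 0 = 3 * a 3 := by
  obtain ⟨h0, h1, hs, -⟩ := hf
  obtain ⟨t, ht, hft⟩ := exists_hasSum_shift 4 hs
  have hb : ball (0 : ℂ) 1 ∈ 𝓝 (0 : ℂ) := ball_mem_nhds _ one_pos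
  have ht' : DifferentiableAt ℂ (deriv t) 0 :=
    (ht.deriv isOpen_ball).differentiableAt hb
  have ht0 : DifferentiableAt ℂ t 0 := ht.differentiableAt hb
  set r : ℂ → ℂ := fun z => 2 * a 2 + 3 * a 3 * z + z ^ 2 * (4 * t z + z * deriv t z) with hr
  have hrd : HasDerivAt r (3 * a 3) 0 := by
    have h2 : DifferentiableAt ℂ (fun z => 4 * t z + z * deriv t z) 0 := by fun_prop
    have := (((hasDerivAt_id (0 : ℂ)).const_mul (3 * a 3)).const_add (2 * a 2)).add
      (((hasDerivAt_id (0 : ℂ)).pow 2).mul h2.hasDerivAt)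
    refine (this.congr_deriv ?_).congr_of_eventuallyEq ?_
    · simp
    · exact .of_forall fun z => by simp [hr]
  have hfd : ∀ z ∈ ball (0 : ℂ) 1, deriv f z = 1 + z * r z := by
    intro z hz
    have htz := (ht.differentiableAt (isOpen_ball.mem_nhds hz)).hasDerivAt
    have hd : HasDerivAt (fun z => z + a 2 * z ^ 2 + a 3 * z ^ 3 + z ^ 4 * t z)
        (1 + z * r z) z := by
      have := (((hasDerivAt_id z).add (((hasDerivAt_id z).pow 2).const_mul (a 2))).add
        (((hasDerivAt_id z).pow 3).const_mul (a 3))).add (((hasDerivAt_id z).pow 4).mul htz)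
      refine this.congr_deriv ?_
      simp [hr]
      ring
    refine (hd.congr_of_eventuallyEq ?_).deriv
    filter_upwards [isOpen_ball.mem_nhds hz] with w hw
    rw [hft w hw]
    simp [Finset.sum_range_succ, h0, h1]
  have hqr : q =ᶠ[𝓝 0] r := by
    rw [← hq.eventuallyEq_nhds_iff_eventuallyEq_nhdsNE hrd.continuousAt]
    filter_upwards [h.filter_mono nhdsWithin_le_nhds, mem_nhdsWithin_of_mem_nhds hb,
      self_mem_nhdsWithin] with z hz hzb hz0
    have := hz.symm.trans (hfd z hzb)
    exact mul_left_cancel₀ hz0 (add_left_cancel this)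
  exact ⟨by rw [hqr.eq_of_nhds]; simp [hr], by rw [hqr.deriv_eq, hrd.deriv]⟩

/-- The coefficients `a₂, a₃` in terms of the Schwarz function `w = z φ`
with `f' = (1 + w) / (1 - w)`. -/
lemma IsR.coeff_of_schwarz {a : ℕ → ℂ} {f φ : ℂ → ℂ} (hf : IsR a f)
    (hφ : DifferentiableAt ℂ φ 0)
    (h : ∀ᶠ z in 𝓝 0, deriv f z = (1 + z * φ z) / (1 - z * φ z)) :
    a 2 = φ 0 ∧ 3 * a 3 = 2 * (deriv φ 0 + φ 0 ^ 2) := by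
  have hc : ContinuousAt (fun z => 1 - z * φ z) 0 :=
    continuousAt_const.sub (continuousAt_id.mul hφ.continuousAt)
  have hne : ∀ᶠ z in 𝓝 0, 1 - z * φ z ≠ 0 := hc.eventually_ne (by simp)
  have hd : HasDerivAt (fun z => 2 * φ z / (1 - z * φ z)) (2 * (deriv φ 0 + φ 0 ^ 2)) 0 := by
    have := (hφ.hasDerivAt.const_mul 2).div
      (((hasDerivAt_id (0 : ℂ)).mul hφ.hasDerivAt).const_sub 1) (by simp)
    refine this.congr_deriv ?_
    simp
    ring
  obtain ⟨e0, e1⟩ := hf.coeff_of_deriv_eq hd.continuousAt (by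
    filter_upwards [h, hne] with z hz hz'
    rw [hz]
    field_simp
    ring)
  rw [hd.deriv] at e1
  exact ⟨by simpa using e0.symm, e1.symm⟩

lemma norm_sub_le_norm_one_sub_conj_mul {b u : ℂ} (hb : ‖b‖ ≤ 1) (hu : ‖u‖ ≤ 1) :
    ‖u - b‖ ≤ ‖1 - conj b * u‖ := by
  have key : ‖1 - conj b * u‖ ^ 2 - ‖u - b‖ ^ 2 = (1 - ‖b‖ ^ 2) * (1 - ‖u‖ ^ 2) := by
    simp only [← Complex.normSq_eq_norm_sq, Complex.normSq_apply]
    simp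
    ring
  refine le_of_pow_le_pow_left₀ two_ne_zero (norm_nonneg _) ?_
  nlinarith [mul_nonneg (sub_nonneg.2 ((sq_le_one_iff₀ (norm_nonneg b)).2 hb))
    (sub_nonneg.2 ((sq_le_one_iff₀ (norm_nonneg u)).2 hu))]

/-- Infinitesimal **Schwarz–Pick** inequality at the origin. -/
lemma norm_deriv_zero_le_one_sub_sq {φ : ℂ → ℂ} (hd : DifferentiableOn ℂ φ (ball 0 1))
    (hb : ∀ z ∈ ball (0 : ℂ) 1, ‖φ z‖ ≤ 1) : ‖deriv φ 0‖ ≤ 1 - ‖φ 0‖ ^ 2 := by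
  have h0 : (0 : ℂ) ∈ ball (0 : ℂ) 1 := by simp
  have hφ0 := (hd.differentiableAt (isOpen_ball.mem_nhds h0)).hasDerivAt
  have key : ∀ r ∈ Ioo (0 : ℝ) 1, r * ‖deriv φ 0‖ ≤ 1 - r ^ 2 * ‖φ 0‖ ^ 2 := by
    rintro r ⟨hr0, hr1⟩
    set b : ℂ := r * φ 0 with hbdef
    have hlt : ∀ z ∈ ball (0 : ℂ) 1, ‖(r : ℂ) * φ z‖ < 1 := fun z hz => by
      rw [norm_mul, Complex.norm_real, Real.norm_of_nonneg hr0.le]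
      nlinarith [hb z hz]
    have hb1 : ‖b‖ < 1 := hlt 0 h0
    have hne : ∀ u : ℂ, ‖u‖ < 1 → 1 - conj b * u ≠ 0 := fun u hu e => by
      have : ‖conj b * u‖ = 1 := by rw [← sub_eq_zero.1 e, norm_one]
      rw [norm_mul, Complex.norm_conj] at this
      nlinarith [norm_nonneg b, norm_nonneg u]
    set ψ : ℂ → ℂ := fun z => (r * φ z - b) / (1 - conj b * (r * φ z)) with hψ
    have hψ0 : ψ 0 = 0 := by simp [hψ, hbdef]
    have hψd : DifferentiableOn ℂ ψ (ball 0 1) :=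
      ((hd.const_mul _).sub_const _).div ((hd.const_mul _).const_mul _ |>.const_sub _)
        fun z hz => hne _ (hlt z hz)
    have hmaps : MapsTo ψ (ball 0 1) (closedBall (ψ 0) 1) := fun z hz => by
      rw [hψ0, mem_closedBall_zero_iff, hψ]
      simp only [norm_div]
      exact div_le_one_of_le₀ (norm_sub_le_norm_one_sub_conj_mul hb1.le (hlt z hz).le)
        (norm_nonneg _)
    have h1 := Complex.norm_deriv_le_one_of_mapsTo_ball hψd hmaps one_pos
    have hbb : conj b * b = ((‖b‖ ^ 2 : ℝ) : ℂ) := by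
      rw [mul_comm, Complex.mul_conj, Complex.normSq_eq_norm_sq]
    have hpos : 0 < 1 - ‖b‖ ^ 2 := by nlinarith [norm_nonneg b]
    have hder : HasDerivAt ψ (r * deriv φ 0 / ((1 - ‖b‖ ^ 2 : ℝ) : ℂ)) 0 := by
      have := ((hφ0.const_mul (r : ℂ)).sub_const b).div
        (((hφ0.const_mul (r : ℂ)).const_mul (conj b)).const_sub 1) (hne b hb1)
      refine this.congr_deriv ?_
      have hn : (1 : ℂ) - conj b * b ≠ 0 := hne b hb1
      rw [Complex.ofReal_sub, ← hbb, ← hbdef, Complex.ofReal_one]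
      field_simp
      ring
    rw [hder.deriv, norm_div, norm_mul, Complex.norm_real, Complex.norm_real,
      Real.norm_of_nonneg hr0.le, Real.norm_of_nonneg hpos.le, div_le_one hpos, hbdef, norm_mul,
      Complex.norm_real, Real.norm_of_nonneg hr0.le, mul_pow] at h1
    exact h1
  have ht : Tendsto (fun r : ℝ => 1 - r ^ 2 * ‖φ 0‖ ^ 2 - r * ‖deriv φ 0‖) (𝓝[<] 1)
      (𝓝 (1 - 1 ^ 2 * ‖φ 0‖ ^ 2 - 1 * ‖deriv φ 0‖)) :=
    (Continuous.tendsto (by fun_prop) 1).mono_left nhdsWithin_le_nhds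
  have := ge_of_tendsto ht (b := 0) (by
    filter_upwards [Ioo_mem_nhdsLT one_pos] with r hr
    linarith [key r hr])
  linarith

/-- The Schwarz function of a function of bounded turning. -/
lemma IsR.exists_schwarz {a : ℕ → ℂ} {f : ℂ → ℂ} (hf : IsR a f) :
    ∃ φ : ℂ → ℂ, DifferentiableOn ℂ φ (ball 0 1) ∧ (∀ z ∈ ball (0 : ℂ) 1, ‖φ z‖ ≤ 1) ∧
      ∀ z ∈ ball (0 : ℂ) 1, deriv f z = (1 + z * φ z) / (1 - z * φ z) := by
  have h0 : (0 : ℂ) ∈ ball (0 : ℂ) 1 := by simp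
  have hdf := (differentiableOn_ball_of_hasSum hf.2.2.1).deriv isOpen_ball
  have hp0 : deriv f 0 = 1 := by
    obtain ⟨t, ht, hft⟩ := exists_hasSum_shift 2 hf.2.2.1
    have hd : HasDerivAt (fun z => z + z ^ 2 * t z) 1 0 := by
      have := (hasDerivAt_id (0 : ℂ)).add (((hasDerivAt_id (0 : ℂ)).pow 2).mul
        (ht.differentiableAt (isOpen_ball.mem_nhds h0)).hasDerivAt)
      exact this.congr_deriv (by simp)
    refine (hd.congr_of_eventuallyEq ?_).deriv
    filter_upwards [isOpen_ball.mem_nhds h0] with w hw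
    rw [hft w hw]
    simp [Finset.sum_range_succ, hf.1, hf.2.1]
  have hpos := hf.2.2.2
  set p := deriv f
  have hne : ∀ z ∈ ball (0 : ℂ) 1, p z + 1 ≠ 0 := fun z hz e => by
    have := congrArg Complex.re e
    simp at this
    linarith [hpos z hz]
  set w : ℂ → ℂ := fun z => (p z - 1) / (p z + 1) with hw
  have hw0 : w 0 = 0 := by simp [hw, hp0]
  have hwd : DifferentiableOn ℂ w (ball 0 1) := (hdf.sub_const 1).div (hdf.add_const 1) hne
  have hmaps : MapsTo w (ball 0 1) (closedBall (w 0) 1) := fun z hz => by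
    rw [hw0, mem_closedBall_zero_iff, hw]
    simp only [norm_div]
    refine div_le_one_of_le₀ (le_of_pow_le_pow_left₀ two_ne_zero (norm_nonneg _) ?_) (norm_nonneg _)
    rw [← Complex.normSq_eq_norm_sq, ← Complex.normSq_eq_norm_sq, Complex.normSq_apply,
      Complex.normSq_apply]
    simp
    nlinarith [hpos z hz]
  refine ⟨dslope w 0, (Complex.differentiableOn_dslope (isOpen_ball.mem_nhds h0)).2 hwd,
    fun z hz => by simpa using Complex.norm_dslope_le_div_of_mapsTo_ball hwd hmaps hz,
    fun z hz => ?_⟩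
  have hz' : z * dslope w 0 z = w z := by
    simpa [hw0] using sub_smul_dslope w 0 z
  rw [hz', hw]
  have h1 := hne z hz
  have h2 : (p z + 1) - (p z - 1) ≠ 0 := by ring_nf; norm_num
  field_simp
  ring

/-- Every `φ` from the disk to its closure yields a function of bounded turning. -/
lemma exists_isR_of_schwarz {φ : ℂ → ℂ} (hd : DifferentiableOn ℂ φ (ball 0 1))
    (hb : ∀ z ∈ ball (0 : ℂ) 1, ‖φ z‖ ≤ 1) :
    ∃ b g, IsR b g ∧ b 2 = φ 0 ∧ 3 * b 3 = 2 * (deriv φ 0 + φ 0 ^ 2) := by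
  have h0 : (0 : ℂ) ∈ ball (0 : ℂ) 1 := by simp
  have hlt : ∀ z ∈ ball (0 : ℂ) 1, ‖z * φ z‖ < 1 := fun z hz => by
    rw [norm_mul]
    have := mem_ball_zero_iff.1 hz
    nlinarith [hb z hz, norm_nonneg z, norm_nonneg (φ z)]
  have hne : ∀ z ∈ ball (0 : ℂ) 1, 1 - z * φ z ≠ 0 := fun z hz e => by
    have := hlt z hz
    rw [← sub_eq_zero.1 e, norm_one] at this
    exact this.false
  have hpd : DifferentiableOn ℂ (fun z => (1 + z * φ z) / (1 - z * φ z)) (ball 0 1) :=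
    ((differentiableOn_id.mul hd).const_add 1).div ((differentiableOn_id.mul hd).const_sub 1) hne
  obtain ⟨G, hG⟩ := hpd.isExactOn_ball
  set g : ℂ → ℂ := fun z => G z - G 0 with hg
  have hg' : ∀ z ∈ ball (0 : ℂ) 1, HasDerivAt g ((1 + z * φ z) / (1 - z * φ z)) z :=
    fun z hz => (hG z hz).sub_const _
  have hgd : DifferentiableOn ℂ g (ball 0 1) :=
    fun z hz => (hg' z hz).differentiableAt.differentiableWithinAt
  have hR : IsR (fun n => (n.factorial : ℂ)⁻¹ * iteratedDeriv n g 0) g := by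
    refine ⟨by simp [hg], by simp [iteratedDeriv_one, (hg' 0 h0).deriv], fun z hz => ?_,
      fun z hz => ?_⟩
    · have := Complex.hasSum_taylorSeries_on_ball hgd hz
      simpa [mul_assoc, mul_comm, mul_left_comm] using this
    · rw [(hg' z hz).deriv]
      have h1 := hlt z hz
      have h2 := hne z hz
      set u := z * φ z
      rw [Complex.div_re, ← add_div]
      refine div_pos ?_ (Complex.normSq_pos.2 h2)
      have h3 : Complex.normSq u < 1 := by
        rw [Complex.normSq_eq_norm_sq]; nlinarith [norm_nonneg u]
      rw [Complex.normSq_apply] at h3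
      simp
      nlinarith
  refine ⟨_, g, hR, hR.coeff_of_schwarz (hd.differentiableAt (isOpen_ball.mem_nhds h0)) ?_⟩
  filter_upwards [isOpen_ball.mem_nhds h0] with z hz
  exact (hg' z hz).deriv

theorem stmt7 (a : ℕ → ℂ) (f : ℂ → ℂ) (hf : IsR a f) :
    -- with `γ₁ = a₂/2` and `γ₂ = (a₃ - a₂²/2)/2`
    (-(1 / Real.sqrt 5) ≤ ‖(a 3 - (a 2) ^ 2 / 2) / 2‖ - ‖a 2 / 2‖ ∧
      ‖(a 3 - (a 2) ^ 2 / 2) / 2‖ - ‖a 2 / 2‖ ≤ 1 / 3) ∧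
    -- sharpness of the upper bound
    (∃ b g, IsR b g ∧ ‖(b 3 - (b 2) ^ 2 / 2) / 2‖ - ‖b 2 / 2‖ = 1 / 3) ∧
    -- sharpness of the lower bound
    (∃ b g, IsR b g ∧ ‖(b 3 - (b 2) ^ 2 / 2) / 2‖ - ‖b 2 / 2‖ = -(1 / Real.sqrt 5)) := by
  have hs5 : (0 : ℝ) < Real.sqrt 5 := by positivity
  have hsq : Real.sqrt 5 ^ 2 = 5 := Real.sq_sqrt (by norm_num)
  have hinv : 1 / Real.sqrt 5 = Real.sqrt 5 / 5 := by
    field_simp; exact hsq.symm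
  have hγ : ∀ {b : ℕ → ℂ} {x d : ℂ}, b 2 = x → 3 * b 3 = 2 * (d + x ^ 2) →
      (b 3 - (b 2) ^ 2 / 2) / 2 = d / 3 + x ^ 2 / 12 := by
    rintro b x d rfl h
    linear_combination h / 6
  refine ⟨?_, ?_, ?_⟩
  · obtain ⟨φ, hd, hb, hφ⟩ := hf.exists_schwarz
    have hb0 : ball (0 : ℂ) 1 ∈ 𝓝 (0 : ℂ) := ball_mem_nhds _ one_pos
    obtain ⟨e2, e3⟩ := hf.coeff_of_schwarz (hd.differentiableAt hb0)
      (by filter_upwards [hb0] with z hz using hφ z hz)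
    have hsp := norm_deriv_zero_le_one_sub_sq hd hb
    rw [hγ e2 e3, e2]
    set d := deriv φ 0
    set x := φ 0
    have n1 : ‖x / 2‖ = ‖x‖ / 2 := by simp
    have n2 : ‖x ^ 2 / 12‖ = ‖x‖ ^ 2 / 12 := by simp
    have n3 : ‖d / 3‖ = ‖d‖ / 3 := by simp
    have hup := norm_add_le (d / 3) (x ^ 2 / 12)
    have hlow := norm_sub_le (d / 3 + x ^ 2 / 12) (d / 3)
    rw [add_sub_cancel_left] at hlow
    have hx := norm_nonneg x
    rw [n2, n3] at hup hlow
    rw [n1, hinv]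
    refine ⟨?_, by nlinarith⟩
    rcases le_total ‖x‖ (2 * Real.sqrt 5 / 5) with hle | hle
    · linarith [norm_nonneg (d / 3 + x ^ 2 / 12)]
    · have hs2 : 2 < Real.sqrt 5 := by nlinarith
      nlinarith
  · obtain ⟨b, g, hR, e2, e3⟩ := exists_isR_of_schwarz (φ := fun z => z) differentiableOn_id
      fun z hz => (mem_ball_zero_iff.1 hz).le
    refine ⟨b, g, hR, ?_⟩
    rw [hγ e2 e3, e2]
    simp
  · set x : ℝ := 2 * Real.sqrt 5 / 5 with hx
    have hx2 : x ^ 2 = 4 / 5 := by rw [hx]; linear_combination 4 / 25 * hsq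
    have hx0 : 0 < x := by positivity
    have hx1 : x < 1 := by nlinarith
    have hne : ∀ z ∈ ball (0 : ℂ) 1, 1 - (x : ℂ) * z ≠ 0 := fun z hz e => by
      have h1 : ‖(x : ℂ) * z‖ = 1 := by rw [← sub_eq_zero.1 e, norm_one]
      rw [norm_mul, Complex.norm_real, Real.norm_of_nonneg hx0.le] at h1
      nlinarith [mem_ball_zero_iff.1 hz, norm_nonneg z]
    have hd : DifferentiableOn ℂ (fun z : ℂ => (x - z) / (1 - x * z)) (ball 0 1) :=
      (differentiableOn_id.const_sub _).div ((differentiableOn_id.const_mul _).const_sub _) hne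
    obtain ⟨b, g, hR, e2, e3⟩ := exists_isR_of_schwarz hd fun z hz => by
      rw [norm_div, norm_sub_rev]
      refine div_le_one_of_le₀ ?_ (norm_nonneg _)
      simpa using norm_sub_le_norm_one_sub_conj_mul (b := (x : ℂ)) (u := z)
        (by simpa [abs_of_pos hx0] using hx1.le) (mem_ball_zero_iff.1 hz).le
    refine ⟨b, g, hR, ?_⟩
    have hd0 : deriv (fun z : ℂ => (x - z) / (1 - x * z)) 0 = x ^ 2 - 1 := by
      have := ((hasDerivAt_id (0 : ℂ)).const_sub (x : ℂ)).div
        (((hasDerivAt_id (0 : ℂ)).const_mul (x : ℂ)).const_sub 1) (by simp)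
      refine this.deriv.trans ?_
      simp
      ring
    rw [hγ e2 e3, e2, hd0, hinv]
    have hx2' : (x : ℂ) ^ 2 = 4 / 5 := by
      rw [← Complex.ofReal_pow, hx2]
      norm_num
    simp [hx2', abs_of_pos hx0]
    norm_num
    rw [hx]
    linarith
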